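/- arXiv:1508.03859 — 2 statements merged into one kernel-verified Lean document; each statement's English description precedes it below -/
import Mathlib

section
/- Let Q be a finite type with s = card Q, let δ : Q → PMF Q be a probabilistic transition function, and let q ≥ 2 be a real number such that for all states a, b, either δ a (b) = 0 or δ a (b) ≥ 1/q. If a state q_a is reachable from a state q_s under the reflexive-transitive closure of the relation 'δ a (b) ≠ 0', then there exists a nonempty duplicate-free list of states whose first entry is q_s, whose last entry is q_a, whose length is at most s, and such that the product over consecutive pairs (x, y) of δ x (y) is at least (1/q)^(s-1). -/
open scoped ENNReal

theorem Relation.ReflTransGen.exists_nodup_isChain {α : Type*} {r : α → α → Prop} {a b : α}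
    (h : Relation.ReflTransGen r a b) :
    ∃ l : List α, (a :: l).Nodup ∧ (a :: l).IsChain r ∧ (a :: l).getLast? = some b := by
  induction h using Relation.ReflTransGen.head_induction_on with
  | refl => exact ⟨[], by simp⟩
  | @head a c hac _ ih =>
    obtain ⟨l, hnd, hch, hlast⟩ := ih
    by_cases ha : a ∈ c :: l
    · obtain ⟨s, t, hst⟩ := List.append_of_mem ha
      rw [hst] at hnd hch hlast
      exact ⟨t, hnd.of_append_right, hch.right_of_append, by simpa using hlast⟩
    · exact ⟨c :: l, List.nodup_cons.2 ⟨ha, hnd⟩, hch.cons_cons hac, by simpa using hlast⟩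

theorem List.IsChain.pow_le_prod_zip_tail {α : Type*} {f : α → α → ℝ≥0∞} {p : ℝ≥0∞} {a : α}
    {l : List α} (h : (a :: l).IsChain fun x y => p ≤ f x y) :
    p ^ l.length ≤ (((a :: l).zip l).map fun x => f x.1 x.2).prod := by
  induction l generalizing a with
  | nil => simp
  | cons b l ih =>
    rw [List.isChain_cons_cons] at h
    simpa [pow_succ'] using mul_le_mul' h.1 (ih h.2)

/-- A solo reachable path can be shortened to a duplicate-free one of length at
most `s = card Q`, and since each transition along it has probability at least
`1/q`, the probability of following it is at least `(1/q)^(s-1)`. -/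
theorem stmt_1 {Q : Type*} [Fintype Q] (δ : Q → PMF Q) (q : ℝ) (hq : 2 ≤ q)
    (hδ : ∀ a b : Q, δ a b = 0 ∨ ENNReal.ofReal (1 / q) ≤ δ a b)
    (q_s q_a : Q)
    (hreach : Relation.ReflTransGen (fun a b => δ a b ≠ 0) q_s q_a) :
    ∃ l : List Q, l ≠ [] ∧ l.Nodup ∧ l.length ≤ Fintype.card Q ∧
      l.head? = some q_s ∧ l.getLast? = some q_a ∧
      ENNReal.ofReal ((1 / q) ^ (Fintype.card Q - 1)) ≤
        ((l.zip l.tail).map (fun p => δ p.1 p.2)).prod := by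
  obtain ⟨l, hnd, hch, hlast⟩ := hreach.exists_nodup_isChain
  have hlen : (q_s :: l).length ≤ Fintype.card Q := hnd.length_le_card
  refine ⟨q_s :: l, by simp, hnd, hlen, rfl, hlast, ?_⟩
  have hp : ENNReal.ofReal (1 / q) ≤ 1 :=
    ENNReal.ofReal_le_one.2 ((div_le_one (by linarith)).2 (by linarith))
  have hch' : (q_s :: l).IsChain fun a b => ENNReal.ofReal (1 / q) ≤ δ a b :=
    hch.imp fun a b hab => (hδ a b).resolve_left hab
  rw [ENNReal.ofReal_pow (by positivity)]
  exact (pow_le_pow_right_of_le_one' hp (Nat.le_sub_one_of_lt hlen)).trans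
    hch'.pow_le_prod_zip_tail
end

section
/- Let ε be a real number with 0 < ε ≤ 1, let s = ⌈log₂(2/ε)⌉ (the natural-number ceiling of the base-2 logarithm), let t be a natural number, and let k : Fin t → ℕ be an injective function with k(i) ≥ 2 for all i. Then the sum over i of (1/2)^(k(i)·s) is at most ε/2. -/
/-- A sum of powers of `x ∈ [0, 1/2]` with distinct exponents, all at least `2`, is at most `x`. -/
theorem sum_pow_le_of_injective {ι : Type*} [Fintype ι] {x : ℝ} (hx0 : 0 ≤ x) (hx : x ≤ 1 / 2)
    {k : ι → ℕ} (hinj : Function.Injective k) (hk2 : ∀ i, 2 ≤ k i) :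
    ∑ i, x ^ k i ≤ x := by
  have hx1 : x < 1 := by linarith
  have hinj' : Function.Injective fun i => k i - 2 := fun i j hij => hinj (by
    have := hk2 i
    have := hk2 j
    simp only at hij
    omega)
  have hgeom : ∑ i, x ^ (k i - 2) ≤ (1 - x)⁻¹ := by
    rw [← tsum_geometric_of_lt_one hx0 hx1, ← tsum_fintype (L := .unconditional ι)]
    exact tsum_comp_le_tsum_of_inj (summable_geometric_of_lt_one hx0 hx1)
      (fun n => pow_nonneg hx0 n) hinj'
  calc ∑ i, x ^ k i = x ^ 2 * ∑ i, x ^ (k i - 2) := by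
        rw [Finset.mul_sum]
        exact Finset.sum_congr rfl fun i _ => by rw [← pow_add, Nat.add_sub_cancel' (hk2 i)]
    _ ≤ x ^ 2 * (1 - x)⁻¹ := by gcongr
    _ ≤ x := by
        rw [← div_eq_mul_inv, div_le_iff₀ (by linarith)]
        nlinarith

/-- `⌈log₂(2/ε)⌉` fair coin flips all agree with a fixed outcome with probability at most `ε/2`. -/
theorem half_pow_ceil_logb_le {ε : ℝ} (hε : 0 < ε) :
    ((1 : ℝ) / 2) ^ ⌈Real.logb 2 (2 / ε)⌉₊ ≤ ε / 2 := by
  have h : 2 / ε ≤ (2 : ℝ) ^ ⌈Real.logb 2 (2 / ε)⌉₊ := by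
    rw [← Real.rpow_natCast, ← Real.logb_le_iff_le_rpow one_lt_two (by positivity)]
    exact Nat.le_ceil _
  rw [one_div, inv_pow, ← inv_div 2 ε]
  exact inv_anti₀ (by positivity) h

/-- Geometric-series estimate for the Fixed Error termination subroutine:
with `s = ⌈log₂(2/ε)⌉` rounds and distinct active-node counts `k i ≥ 2`,
`∑ i, (1/2)^(k i · s) ≤ ε/2`. -/
theorem stmt_7 (ε : ℝ) (hε0 : 0 < ε) (hε1 : ε ≤ 1) (t : ℕ) (k : Fin t → ℕ)
    (hinj : Function.Injective k) (hk2 : ∀ i, 2 ≤ k i) :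
    ∑ i, ((1 : ℝ) / 2) ^ (k i * ⌈Real.logb 2 (2 / ε)⌉₊) ≤ ε / 2 := by
  have hs := half_pow_ceil_logb_le hε0
  simp only [mul_comm (k _), pow_mul]
  exact (sum_pow_le_of_injective (by positivity) (by linarith) hinj hk2).trans hs
end
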